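/- Let W be a finite Coxeter group and x, y ∈ W. Suppose all right descents of y commute with each other. If x ≤ y in the strong Bruhat order, then Pop(x) ≤ Pop(y) in the strong Bruhat order. -/

import Mathlib

namespace CoxPop

variable {B W : Type*} [Group W] {M : CoxeterMatrix B} (cs : CoxeterSystem M W)

/-- The standard parabolic subgroup generated by the simple reflections indexed by `J`. -/
def parabolic (J : Set B) : Subgroup W :=
  Subgroup.closure (cs.simple '' J)

/-- The right descent set of `w`. -/
def D (w : W) : Set B := {i | cs.IsRightDescent w i}

/-- `u` is a longest element of the standard parabolic subgroup `W_J`. -/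
def IsLongestIn (J : Set B) (u : W) : Prop :=
  u ∈ parabolic cs J ∧ ∀ v ∈ parabolic cs J, cs.length v ≤ cs.length u

open Classical in
/-- The longest element `w₀(J)` of the standard parabolic subgroup `W_J`. -/
noncomputable def w0 (J : Set B) : W :=
  if h : ∃ u, IsLongestIn cs J u then h.choose else 1

/-- The Coxeter pop-stack-sorting operator: `Pop w = w * w₀(D_R(w))`. -/
noncomputable def Pop (w : W) : W := w * w0 cs (D cs w)

/-- The right weak order on `W`: `x ≤_R y` iff `ℓ(x) + ℓ(x⁻¹y) = ℓ(y)`. -/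
def rweakLE (x y : W) : Prop := cs.length x + cs.length (x⁻¹ * y) = cs.length y

/-- `u` is the minimal-length representative `ᴶw` of the right coset `W_J w`. -/
def IsMinRep (J : Set B) (w u : W) : Prop :=
  (∃ p ∈ parabolic cs J, u = p * w) ∧
    ∀ v : W, (∃ p ∈ parabolic cs J, v = p * w) → cs.length u ≤ cs.length v

/-- A map `f : W → W` is compulsive if `f(w) ≤_R w` and `f(w) ≤_R ws` for every
right descent `s` of `w`. -/
def Compulsive (f : W → W) : Prop :=
  ∀ w : W, rweakLE cs (f w) w ∧ ∀ i ∈ D cs w, rweakLE cs (f w) (w * cs.simple i)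

/-- The strong Bruhat order: `x ≤ y` iff some reduced word for `y` contains a
reduced word for `x` as a (not necessarily contiguous) subword. -/
def bruhatLE (x y : W) : Prop :=
  ∃ ω : List B, cs.wordProd ω = y ∧ ω.length = cs.length y ∧
    ∃ ω' : List B, ω'.Sublist ω ∧ cs.wordProd ω' = x ∧ ω'.length = cs.length x

/-- The Coxeter system is irreducible: its Coxeter diagram is connected, i.e. the
index set admits no nontrivial partition into two mutually commuting parts. -/
def Irreducible : Prop :=
  ∀ J : Set B, (∀ i ∈ J, ∀ j ∈ Jᶜ, M i j = 2) → J = ∅ ∨ J = Set.univ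

open CoxeterSystem

/-! ### The strong exchange property -/

theorem leftInvSeq_eq_map_conj_rightInvSeq (ω : List B) :
    cs.leftInvSeq ω = (cs.rightInvSeq ω).map (MulAut.conj (cs.wordProd ω)) := by
  induction ω with
  | nil => simp
  | cons i ω ih => simp [leftInvSeq, rightInvSeq, ih, wordProd_cons, mul_assoc]

theorem wordProd_alternatingWord_two_mul (i j : B) :
    cs.wordProd (alternatingWord i j (2 * M i j)) = 1 := by
  simp [prod_alternatingWord_eq_mul_pow]

open Classical in
theorem even_count_rightInvSeq_alternatingWord (i j : B) (t : W) :
    Even ((cs.rightInvSeq (alternatingWord i j (2 * M i j))).count t) := by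
  have hlis : cs.rightInvSeq (alternatingWord i j (2 * M i j)) =
      cs.leftInvSeq (alternatingWord i j (2 * M i j)) := by
    simp [leftInvSeq_eq_map_conj_rightInvSeq, wordProd_alternatingWord_two_mul]
  rw [hlis]
  set L := cs.leftInvSeq (alternatingWord i j (2 * M i j)) with hL
  have hlen : L.length = 2 * M i j := by simp [hL]
  have hhalf : L.take (M i j) = L.drop (M i j) := by
    apply List.ext_getElem
    · simp [hlen]; omega
    · intro k h₁ h₂
      have hk : k < M i j := by simp [hlen] at h₁; omega
      simp only [List.getElem_take, List.getElem_drop, hL]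
      rw [cs.getElem_leftInvSeq_alternatingWord i j (M i j) k (by omega),
        cs.getElem_leftInvSeq_alternatingWord i j (M i j) (M i j + k) (by omega)]
      have h₃ : ¬ Even (2 * k + 1) := by simp
      have h₄ : ¬ Even (2 * (M i j + k) + 1) := by simp
      simp only [prod_alternatingWord_eq_mul_pow, h₃, h₄, if_false]
      rw [show (2 * (M i j + k) + 1) / 2 = M i j + k by omega,
        show (2 * k + 1) / 2 = k by omega, pow_add]
      simp
  rw [← List.take_append_drop (M i j) L, List.count_append, hhalf]
  exact ⟨_, rfl⟩

open Classical in
/-- The action of a simple reflection on signed group elements: conjugation, with a change of sign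
exactly at the reflection itself. -/
noncomputable def signedConj (i : B) : Function.End (W × ZMod 2) :=
  fun p ↦ (cs.simple i * p.1 * cs.simple i, p.2 + if p.1 = cs.simple i then 1 else 0)

open Classical in
theorem prod_map_signedConj (ω : List B) (t : W) (ε : ZMod 2) :
    (ω.map (signedConj cs)).prod (t, ε) =
      (cs.wordProd ω * t * (cs.wordProd ω)⁻¹, ε + (cs.rightInvSeq ω).count t) := by
  induction ω with
  | nil => simp [Function.End.one_def]
  | cons i ω ih =>
    rw [List.map_cons, List.prod_cons]
    change signedConj cs i ((ω.map (signedConj cs)).prod (t, ε)) = _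
    rw [ih]
    have h : cs.wordProd ω * t * (cs.wordProd ω)⁻¹ = cs.simple i ↔
        (cs.wordProd ω)⁻¹ * cs.simple i * cs.wordProd ω = t := by
      constructor
      · intro h
        rw [← h]; group
      · rintro rfl
        group
    simp only [signedConj, rightInvSeq, wordProd_cons, List.count_cons, h, beq_iff_eq]
    ext
    · simp [mul_assoc]
    · push_cast
      simp [add_assoc]

theorem prod_map_alternatingWord {G : Type*} [Monoid G] (f : B → G) (i j : B) (m : ℕ) :
    ((alternatingWord i j (2 * m)).map f).prod = (f i * f j) ^ m := by
  induction m with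
  | zero => simp [alternatingWord]
  | succ m ih =>
    rw [show 2 * (m + 1) = 2 * m + 1 + 1 by ring, alternatingWord_succ, alternatingWord_succ]
    simp [ih, pow_succ]

theorem isLiftable_signedConj : M.IsLiftable (signedConj cs) := by
  classical
  intro i j
  rw [← prod_map_alternatingWord]
  funext ⟨t, ε⟩
  rw [prod_map_signedConj, wordProd_alternatingWord_two_mul,
    (ZMod.natCast_eq_zero_iff_even).2 (even_count_rightInvSeq_alternatingWord cs i j t)]
  simp [Function.End.one_def]

/-- The action of the group on signed group elements. -/
noncomputable def signedConjHom : W →* Function.End (W × ZMod 2) :=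
  cs.lift ⟨signedConj cs, isLiftable_signedConj cs⟩

open Classical in
theorem signedConjHom_wordProd (ω : List B) (t : W) (ε : ZMod 2) :
    signedConjHom cs (cs.wordProd ω) (t, ε) =
      (cs.wordProd ω * t * (cs.wordProd ω)⁻¹, ε + (cs.rightInvSeq ω).count t) := by
  have h : signedConjHom cs ∘ cs.simple = signedConj cs :=
    funext (cs.lift_apply_simple (isLiftable_signedConj cs))
  rw [← prod_map_signedConj, wordProd, map_list_prod, List.map_map, h]

theorem signedConjHom_mul (v w : W) (p : W × ZMod 2) :
    signedConjHom cs (v * w) p = signedConjHom cs v (signedConjHom cs w p) := by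
  rw [map_mul]; rfl

theorem signedConjHom_apply (w t : W) (ε : ZMod 2) :
    signedConjHom cs w (t, ε) = (w * t * w⁻¹, ε + (signedConjHom cs w (t, 0)).2) := by
  classical
  obtain ⟨ω, rfl⟩ := cs.wordProd_surjective w
  simp [signedConjHom_wordProd]

theorem signedConjHom_reflection {t : W} (ht : cs.IsReflection t) (ε : ZMod 2) :
    signedConjHom cs t (t, ε) = (t, ε + 1) := by
  obtain ⟨w, i, rfl⟩ := ht
  have hs (δ : ZMod 2) :
      signedConjHom cs (cs.simple i) (cs.simple i, δ) = (cs.simple i, δ + 1) := by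
    classical
    simpa using signedConjHom_wordProd cs [i] (cs.simple i) δ
  have hid := signedConjHom_mul cs w w⁻¹ (w * cs.simple i * w⁻¹, ε)
  rw [mul_inv_cancel, map_one, signedConjHom_apply cs w⁻¹,
    show w⁻¹ * (w * cs.simple i * w⁻¹) * w⁻¹⁻¹ = cs.simple i by group,
    signedConjHom_apply cs w] at hid
  have hid' := congrArg Prod.snd hid
  rw [signedConjHom_mul, signedConjHom_mul, signedConjHom_apply cs w⁻¹,
    show w⁻¹ * (w * cs.simple i * w⁻¹) * w⁻¹⁻¹ = cs.simple i by group, hs,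
    signedConjHom_apply cs w]
  ext
  · rfl
  · change ε = _ at hid'
    change _ + _ = _
    conv_rhs => rw [hid']
    ring

/-- Every right inversion of a word's product occurs in the right inversion sequence. -/
theorem mem_rightInvSeq_of_isRightInversion {ω : List B} {t : W}
    (h : cs.IsRightInversion (cs.wordProd ω) t) : t ∈ cs.rightInvSeq ω := by
  classical
  by_contra hmem
  have h₀ : (signedConjHom cs (cs.wordProd ω) (t, 0)).2 = 0 := by
    simp [signedConjHom_wordProd, List.count_eq_zero_of_not_mem hmem]
  obtain ⟨τ, hτ, hprod⟩ := cs.exists_isReduced (cs.wordProd ω * t)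
  have h₁ : (signedConjHom cs (cs.wordProd τ) (t, 0)).2 = 1 := by
    rw [← hprod, signedConjHom_mul, signedConjHom_reflection cs h.1, signedConjHom_apply, h₀]
    simp
  have hτmem : t ∈ cs.rightInvSeq τ := by
    by_contra hτmem
    simp [signedConjHom_wordProd, List.count_eq_zero_of_not_mem hτmem] at h₁
  have hinv := cs.isRightInversion_of_mem_rightInvSeq hτ hτmem
  rw [← hprod] at hinv
  exact h.1.isRightInversion_mul_left_iff.1 hinv h

/-- The strong exchange property. -/
theorem exists_wordProd_eraseIdx {ω : List B} {t : W}
    (h : cs.IsRightInversion (cs.wordProd ω) t) :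
    ∃ k < ω.length, cs.wordProd ω * t = cs.wordProd (ω.eraseIdx k) := by
  obtain ⟨k, hk, rfl⟩ := List.mem_iff_getElem.1 (mem_rightInvSeq_of_isRightInversion cs h)
  refine ⟨k, by simpa using hk, ?_⟩
  rw [← wordProd_mul_getD_rightInvSeq, List.getD_eq_getElem _ _ hk]

/-! ### The Bruhat order as a chain of reflections -/

/-- One step up in the Bruhat graph: right multiplication by a reflection increasing the length. -/
def BruhatStep (u v : W) : Prop :=
  ∃ t, cs.IsReflection t ∧ v = u * t ∧ cs.length u < cs.length v

/-- The Bruhat order, described by chains of reflections. -/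
def BruhatChain : W → W → Prop := Relation.ReflTransGen (BruhatStep cs)

theorem BruhatChain.trans {cs : CoxeterSystem M W} {u v w : W} (h₁ : BruhatChain cs u v)
    (h₂ : BruhatChain cs v w) : BruhatChain cs u w :=
  Relation.ReflTransGen.trans h₁ h₂

theorem bruhatStep_mul_simple {u : W} {i : B}
    (h : cs.length u < cs.length (u * cs.simple i)) :
    BruhatStep cs u (u * cs.simple i) :=
  ⟨cs.simple i, cs.isReflection_simple i, rfl, h⟩

theorem bruhatStep_mul_simple_of_isRightDescent {u : W} {i : B} (h : cs.IsRightDescent u i) :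
    BruhatStep cs (u * cs.simple i) u :=
  ⟨cs.simple i, cs.isReflection_simple i, by simp, h⟩

theorem BruhatStep.mul_simple {cs : CoxeterSystem M W} {u v : W} (h : BruhatStep cs u v) (i : B) :
    BruhatStep cs (u * cs.simple i) (v * cs.simple i) ∨ v = u * cs.simple i := by
  obtain ⟨t, ht, rfl, hlt⟩ := h
  have hr : cs.IsReflection (cs.simple i * t * cs.simple i) := by
    simpa using ht.conj (cs.simple i)
  have hmul : u * t * cs.simple i = u * cs.simple i * (cs.simple i * t * cs.simple i) := by
    simp [mul_assoc]
  rcases (hr.length_mul_left_ne (u * cs.simple i)).lt_or_gt with hdown | hup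
  · right
    obtain ⟨ω, hω, rfl⟩ := cs.exists_isReduced u
    have hconcat : cs.wordProd (ω ++ [i]) = cs.wordProd ω * cs.simple i := by
      simp [wordProd_append]
    obtain ⟨k, hk, hprod⟩ := exists_wordProd_eraseIdx cs (ω := ω ++ [i]) ⟨hr, by rwa [hconcat]⟩
    rw [hconcat, ← hmul] at hprod
    rcases lt_or_ge k ω.length with hkω | hkω
    · rw [List.eraseIdx_append_of_lt_length hkω, wordProd_append, wordProd_singleton] at hprod
      have hle := cs.length_wordProd_le (ω.eraseIdx k)
      rw [← mul_right_cancel hprod, List.length_eraseIdx_of_lt hkω] at hle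
      have := hω.eq
      omega
    · rw [List.eraseIdx_append_of_length_le hkω] at hprod
      obtain rfl : k = ω.length := by simp at hk; omega
      simp only [Nat.sub_self, List.eraseIdx_cons_zero, List.append_nil] at hprod
      nth_rw 2 [← hprod]
      simp
  · left
    exact ⟨_, hr, hmul, by rwa [hmul]⟩

theorem BruhatChain.mul_simple_left {cs : CoxeterSystem M W} {u v : W} (h : BruhatChain cs u v)
    (i : B) :
    BruhatChain cs (u * cs.simple i) v ∨
      BruhatChain cs (u * cs.simple i) (v * cs.simple i) := by
  induction h with
  | refl => exact .inr .refl
  | tail _ hstep ih =>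
    rcases ih with ih | ih
    · exact .inl (ih.tail hstep)
    · rcases hstep.mul_simple i with hs | rfl
      · exact .inr (ih.tail hs)
      · exact .inl ih

theorem BruhatChain.mul_simple_right {cs : CoxeterSystem M W} {u v : W} (h : BruhatChain cs u v)
    (i : B) :
    BruhatChain cs u (v * cs.simple i) ∨
      BruhatChain cs (u * cs.simple i) (v * cs.simple i) := by
  induction h using Relation.ReflTransGen.head_induction_on with
  | refl => exact .inr .refl
  | head hstep _ ih =>
    rcases ih with ih | ih
    · exact .inl (ih.head hstep)
    · rcases hstep.mul_simple i with hs | rfl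
      · exact .inr (ih.head hs)
      · exact .inl (by simpa using ih)

theorem BruhatChain.mul_simple_le {cs : CoxeterSystem M W} {u v : W} (h : BruhatChain cs u v)
    {i : B} (hi : cs.IsRightDescent v i) : BruhatChain cs (u * cs.simple i) v :=
  (h.mul_simple_left i).elim id
    fun h ↦ h.tail (bruhatStep_mul_simple_of_isRightDescent cs hi)

theorem BruhatChain.length_le {cs : CoxeterSystem M W} {u v : W} (h : BruhatChain cs u v) :
    cs.length u ≤ cs.length v := by
  induction h with
  | refl => exact le_rfl
  | tail _ hstep ih =>
    obtain ⟨_, _, _, hlt⟩ := hstep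
    exact ih.trans hlt.le

theorem BruhatChain.eq_of_length_le {cs : CoxeterSystem M W} {u v : W} (h : BruhatChain cs u v)
    (hle : cs.length v ≤ cs.length u) : u = v := by
  rcases Relation.ReflTransGen.cases_head h with rfl | ⟨w, ⟨_, _, _, hlt⟩, hw⟩
  · rfl
  · have := BruhatChain.length_le hw
    omega

/-- The subword property: an element below the product of a reduced word is the product of one
of its reduced subwords. -/
theorem BruhatChain.exists_sublist {cs : CoxeterSystem M W} {u : W} {ω : List B}
    (hω : cs.IsReduced ω) (h : BruhatChain cs u (cs.wordProd ω)) :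
    ∃ τ : List B, τ.Sublist ω ∧ cs.wordProd τ = u ∧ τ.length = cs.length u := by
  induction ω using List.reverseRecOn generalizing u with
  | nil =>
    have hlen := h.length_le
    simp only [wordProd_nil, length_one, Nat.le_zero, length_eq_zero_iff] at hlen
    exact ⟨[], by simp [hlen]⟩
  | append_singleton ω i ih =>
    have hω' : cs.IsReduced ω := by simpa using hω.take ω.length
    have hprod : cs.wordProd (ω ++ [i]) * cs.simple i = cs.wordProd ω := by
      simp [wordProd_append]
    have hlow := h.mul_simple_right i
    rw [hprod] at hlow
    rcases cs.length_mul_simple u i with hup | hdown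
    · have hu : BruhatChain cs u (cs.wordProd ω) := hlow.elim id fun h ↦
        h.head (bruhatStep_mul_simple cs (by omega))
      obtain ⟨τ, hsub, hτ⟩ := ih hω' hu
      exact ⟨τ, hsub.trans (List.sublist_append_left ω [i]), hτ⟩
    · have hu : BruhatChain cs (u * cs.simple i) (cs.wordProd ω) := hlow.elim
        (fun h ↦ h.head (bruhatStep_mul_simple_of_isRightDescent cs
          (cs.isRightDescent_iff.2 hdown))) id
      obtain ⟨τ, hsub, hτ, hlen⟩ := ih hω' hu
      refine ⟨τ ++ [i], hsub.append_right [i], ?_, ?_⟩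
      · simp [wordProd_append, hτ]
      · simp [hlen, hdown]

theorem bruhatChain_of_sublist {ω τ : List B} (hω : cs.IsReduced ω) (hsub : τ.Sublist ω) :
    BruhatChain cs (cs.wordProd τ) (cs.wordProd ω) := by
  induction ω using List.reverseRecOn generalizing τ with
  | nil => rw [List.sublist_nil.1 hsub]; exact .refl
  | append_singleton ω i ih =>
    have hω' : cs.IsReduced ω := by simpa using hω.take ω.length
    have hprod : cs.wordProd (ω ++ [i]) = cs.wordProd ω * cs.simple i := by
      simp [wordProd_append]
    have hlt : cs.length (cs.wordProd ω) < cs.length (cs.wordProd ω * cs.simple i) := by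
      rw [← hprod, hω.eq, hω'.eq]; simp
    have hdesc : cs.IsRightDescent (cs.wordProd ω * cs.simple i) i := by
      simpa [IsRightDescent] using hlt
    obtain ⟨τ₁, τ₂, rfl, h₁, h₂⟩ := List.sublist_append_iff.1 hsub
    have hchain : BruhatChain cs _ _ := (ih hω' h₁).tail (bruhatStep_mul_simple cs hlt)
    rw [hprod, wordProd_append]
    rcases List.sublist_singleton.1 h₂ with rfl | rfl
    · simpa using hchain
    · simpa using BruhatChain.mul_simple_le hchain hdesc

theorem bruhatLE_iff_bruhatChain {x y : W} : bruhatLE cs x y ↔ BruhatChain cs x y := by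
  constructor
  · rintro ⟨ω, rfl, hω, τ, hsub, rfl, -⟩
    exact bruhatChain_of_sublist cs hω.symm hsub
  · intro h
    obtain ⟨ω, hω, rfl⟩ := cs.exists_isReduced y
    exact ⟨ω, rfl, hω.eq.symm, h.exists_sublist hω⟩

/-! ### Minimal coset representatives and longest elements -/

theorem simple_mem_parabolic {J : Set B} {i : B} (hi : i ∈ J) :
    cs.simple i ∈ parabolic cs J :=
  Subgroup.subset_closure ⟨i, hi, rfl⟩

theorem wordProd_mem_parabolic {J : Set B} {ω : List B} (hω : ∀ i ∈ ω, i ∈ J) :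
    cs.wordProd ω ∈ parabolic cs J := by
  refine Subgroup.list_prod_mem _ fun x hx ↦ ?_
  obtain ⟨i, hi, rfl⟩ := List.mem_map.1 hx
  exact simple_mem_parabolic cs (hω i hi)

@[elab_as_elim]
theorem parabolic_induction {cs : CoxeterSystem M W} {J : Set B}
    {p : (u : W) → u ∈ parabolic cs J → Prop} (one : p 1 (one_mem _))
    (mul : ∀ u hu i (hi : i ∈ J), p u hu →
      p (u * cs.simple i) (mul_mem hu (simple_mem_parabolic cs hi)))
    {u : W} (hu : u ∈ parabolic cs J) : p u hu := by
  induction hu using Subgroup.closure_induction_right with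
  | one => exact one
  | mul_right u hu s hs ih =>
    obtain ⟨i, hi, rfl⟩ := hs
    exact mul u hu i hi ih
  | mul_inv_cancel u hu s hs ih =>
    obtain ⟨i, hi, rfl⟩ := hs
    simpa using mul u hu i hi ih

/-- `m` has minimal length in its left coset `m W_J`. -/
def IsMinInCoset (J : Set B) (m : W) : Prop :=
  ∀ u ∈ parabolic cs J, cs.length m ≤ cs.length (m * u)

theorem exists_isMinInCoset (J : Set B) (x : W) :
    ∃ m, IsMinInCoset cs J m ∧ ∃ u ∈ parabolic cs J, x = m * u := by
  obtain ⟨u, hu, hmin⟩ := WellFounded.has_min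
    (InvImage.wf (fun u ↦ cs.length (x * u)) wellFounded_lt)
    (parabolic cs J : Set W) ⟨1, one_mem _⟩
  refine ⟨x * u, fun v hv ↦ ?_, u⁻¹, inv_mem hu, by simp⟩
  rw [mul_assoc]
  exact not_lt.1 (hmin (u * v) (mul_mem hu hv))

theorem IsMinInCoset.exists_word {cs : CoxeterSystem M W} {J : Set B} {m u : W}
    (hm : IsMinInCoset cs J m) (hu : u ∈ parabolic cs J) :
    ∃ ω : List B, (∀ i ∈ ω, i ∈ J) ∧ cs.wordProd ω = u ∧
      cs.length (m * u) = cs.length m + ω.length := by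
  induction hu using parabolic_induction with
  | one => exact ⟨[], by simp⟩
  | mul u hu i hi ih =>
    obtain ⟨ω, hJ, rfl, hlen⟩ := ih
    rcases cs.length_mul_simple (m * cs.wordProd ω) i with hup | hdown
    · refine ⟨ω ++ [i], ?_, by simp [wordProd_append], ?_⟩
      · simp only [List.mem_append, List.mem_singleton]
        rintro j (hj | rfl)
        exacts [hJ j hj, hi]
      · rw [← mul_assoc, hup, hlen]; simp [add_assoc]
    · obtain ⟨μ, hμ, rfl⟩ := cs.exists_isReduced m
      have hinv : cs.IsRightInversion (cs.wordProd (μ ++ ω)) (cs.simple i) := by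
        rw [isRightInversion_simple_iff_isRightDescent, isRightDescent_iff, wordProd_append]
        exact hdown
      obtain ⟨k, hk, hprod⟩ := exists_wordProd_eraseIdx cs hinv
      rcases lt_or_ge k μ.length with hkμ | hkμ
      · rw [List.eraseIdx_append_of_lt_length hkμ, wordProd_append, wordProd_append] at hprod
        have hle := cs.length_wordProd_le (μ.eraseIdx k)
        rw [eq_mul_inv_iff_mul_eq.2 hprod.symm, List.length_eraseIdx_of_lt hkμ, mul_assoc,
          mul_assoc] at hle
        have hmin := hm (cs.wordProd ω * (cs.simple i * (cs.wordProd ω)⁻¹))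
          (mul_mem hu (mul_mem (simple_mem_parabolic cs hi) (inv_mem hu)))
        have := hμ.eq
        omega
      · rw [List.eraseIdx_append_of_length_le hkμ, wordProd_append, wordProd_append, mul_assoc,
          mul_right_inj] at hprod
        have hk' : k - μ.length < ω.length := by simp at hk; omega
        refine ⟨ω.eraseIdx (k - μ.length), fun j hj ↦ hJ j (List.mem_of_mem_eraseIdx hj),
          hprod.symm, ?_⟩
        rw [List.length_eraseIdx_of_lt hk', ← mul_assoc]
        omega

theorem IsMinInCoset.length_mul {cs : CoxeterSystem M W} {J : Set B} {m u : W}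
    (hm : IsMinInCoset cs J m) (hu : u ∈ parabolic cs J) :
    cs.length (m * u) = cs.length m + cs.length u := by
  obtain ⟨ω, -, rfl, hlen⟩ := hm.exists_word hu
  have h₁ := cs.length_mul_le m (cs.wordProd ω)
  have h₂ := cs.length_wordProd_le ω
  omega

theorem bruhatChain_mul_of_length_mul {m u : W}
    (h : cs.length (m * u) = cs.length m + cs.length u) : BruhatChain cs m (m * u) := by
  obtain ⟨μ, hμ, rfl⟩ := cs.exists_isReduced m
  obtain ⟨ω, hω, rfl⟩ := cs.exists_isReduced u
  rw [← wordProd_append] at h ⊢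
  refine bruhatChain_of_sublist cs ?_ (List.sublist_append_left μ ω)
  rw [CoxeterSystem.IsReduced, h, hμ.eq, hω.eq, List.length_append]

theorem IsMinInCoset.bruhatChain {cs : CoxeterSystem M W} {J : Set B} {m u : W}
    (hm : IsMinInCoset cs J m) (hu : u ∈ parabolic cs J) : BruhatChain cs m (m * u) :=
  bruhatChain_mul_of_length_mul cs (hm.length_mul hu)

/-- An element is the greatest one in its coset modulo a set of right descents. -/
theorem bruhatChain_mul_of_descents {J : Set B} {v u : W} (hv : ∀ i ∈ J, cs.IsRightDescent v i)
    (hu : u ∈ parabolic cs J) : BruhatChain cs (v * u) v := by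
  induction hu using parabolic_induction with
  | one => rw [mul_one]; exact .refl
  | mul u _ i hi ih =>
    rw [← mul_assoc]
    exact ih.mul_simple_le (hv i hi)

theorem IsLongestIn.eq {cs : CoxeterSystem M W} {J : Set B} {u v : W} (hu : IsLongestIn cs J u)
    (hv : v ∈ parabolic cs J) (hdesc : ∀ i ∈ J, cs.IsRightDescent v i) : u = v := by
  have h := bruhatChain_mul_of_descents cs hdesc (mul_mem (inv_mem hv) hu.1)
  rw [mul_inv_cancel_left] at h
  exact h.eq_of_length_le (hu.2 v hv)

theorem IsLongestIn.inv {cs : CoxeterSystem M W} {J : Set B} {u : W} (hu : IsLongestIn cs J u) :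
    IsLongestIn cs J u⁻¹ :=
  ⟨inv_mem hu.1, fun v hv ↦ by simpa using hu.2 v hv⟩

theorem isLongestIn_w0 [Finite W] (J : Set B) : IsLongestIn cs J (w0 cs J) := by
  have h : ∃ u, IsLongestIn cs J u := by
    obtain ⟨u, hu, hmax⟩ := Set.exists_max_image (parabolic cs J : Set W) cs.length
      (Set.toFinite _) ⟨1, one_mem _⟩
    exact ⟨u, hu, hmax⟩
  rw [w0, dif_pos h]
  exact h.choose_spec

/-- `Pop x` is the minimal representative of `x` modulo its right descents. -/
theorem isMinInCoset_Pop [Finite W] (x : W) : IsMinInCoset cs (D cs x) (Pop cs x) := by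
  obtain ⟨m, hm, u, hu, hx⟩ := exists_isMinInCoset cs (D cs x) x
  have hdesc : ∀ i ∈ D cs x, cs.IsRightDescent u i := by
    intro i hi
    have h : cs.length (x * cs.simple i) < cs.length x := hi
    rw [hx, mul_assoc, hm.length_mul (mul_mem hu (simple_mem_parabolic cs hi)),
      hm.length_mul hu] at h
    exact Nat.lt_of_add_lt_add_left h
  have hw := (isLongestIn_w0 cs (D cs x)).inv.eq hu hdesc
  have hpop : Pop cs x = m := by
    rw [Pop, ← inv_inv (w0 cs (D cs x)), hw]
    nth_rw 1 [hx]
    simp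
  rwa [hpop]

theorem exists_eq_Pop_mul [Finite W] (x : W) :
    ∃ u ∈ parabolic cs (D cs x), x = Pop cs x * u :=
  ⟨(w0 cs (D cs x))⁻¹, inv_mem (isLongestIn_w0 cs _).1, by simp [Pop]⟩

/-- If `x ≤ m u` with `u ∈ W_J`, then some element of `x W_J` lies below `m`. -/
theorem BruhatChain.exists_mul_parabolic {cs : CoxeterSystem M W} {J : Set B} {m u : W}
    (hu : u ∈ parabolic cs J) {x : W} (h : BruhatChain cs x (m * u)) :
    ∃ v ∈ parabolic cs J, BruhatChain cs (x * v) m := by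
  induction hu using parabolic_induction generalizing x with
  | one => exact ⟨1, one_mem _, by simpa using h⟩
  | mul u _ i hi ih =>
    have hlow := h.mul_simple_right i
    simp only [mul_assoc, simple_mul_simple_self, mul_one] at hlow
    rcases hlow with hlow | hlow
    · exact ih hlow
    · obtain ⟨v, hv, hchain⟩ := ih hlow
      exact ⟨cs.simple i * v, mul_mem (simple_mem_parabolic cs hi) hv,
        by simpa [mul_assoc] using hchain⟩

theorem wordProd_mul_simple_of_commute {ω : List B} {i : B} (hi : i ∈ ω)
    (hcomm : ∀ j ∈ ω, Commute (cs.simple j) (cs.simple i)) :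
    ∃ τ : List B, τ.length < ω.length ∧ cs.wordProd ω * cs.simple i = cs.wordProd τ := by
  obtain ⟨α, β, rfl⟩ := List.append_of_mem hi
  refine ⟨α ++ β, by simp, ?_⟩
  have h : Commute (cs.wordProd β) (cs.simple i) := by
    refine Commute.list_prod_left _ _ fun s hs ↦ ?_
    obtain ⟨j, hj, rfl⟩ := List.mem_map.1 hs
    exact hcomm j (by simp [hj])
  simp [wordProd_append, wordProd_cons, mul_assoc, h.eq]

/-- If the generators in `J` commute, the `W_J`-component of `x` only involves right descents
of `x`. -/
theorem IsMinInCoset.mem_parabolic_D {cs : CoxeterSystem M W} {J : Set B} {m u : W}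
    (hm : IsMinInCoset cs J m) (hu : u ∈ parabolic cs J)
    (hJ : ∀ i ∈ J, ∀ j ∈ J, cs.simple i * cs.simple j = cs.simple j * cs.simple i) :
    u ∈ parabolic cs (D cs (m * u)) := by
  obtain ⟨ω, hω, rfl, hlen⟩ := hm.exists_word hu
  refine wordProd_mem_parabolic cs fun i hi ↦ ?_
  obtain ⟨τ, hτ, hprod⟩ := wordProd_mul_simple_of_commute cs hi
    fun j hj ↦ hJ j (hω j hj) i (hω i hi)
  change cs.length (m * cs.wordProd ω * cs.simple i) < cs.length (m * cs.wordProd ω)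
  rw [mul_assoc, hprod, hlen]
  have h₁ := cs.length_mul_le m (cs.wordProd τ)
  have h₂ := cs.length_wordProd_le τ
  omega

/-- in a finite Coxeter group, if all right descents of `y` commute with
each other and `x ≤ y` in the strong Bruhat order, then `Pop x ≤ Pop y` in the strong
Bruhat order. -/
theorem pop_bruhat_monotone [Finite W] (x y : W)
    (hy : ∀ i ∈ D cs y, ∀ j ∈ D cs y,
      cs.simple i * cs.simple j = cs.simple j * cs.simple i)
    (hxy : bruhatLE cs x y) : bruhatLE cs (Pop cs x) (Pop cs y) := by
  rw [bruhatLE_iff_bruhatChain] at hxy ⊢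
  obtain ⟨p, hp, hyp⟩ := exists_eq_Pop_mul cs y
  obtain ⟨a, ha, u, hu, rfl⟩ := exists_isMinInCoset cs (D cs y) x
  rw [hyp] at hxy
  obtain ⟨v, hv, hlow⟩ := hxy.exists_mul_parabolic hp
  have hay : BruhatChain cs a (Pop cs y) :=
    (ha.bruhatChain (mul_mem hu hv)).trans (by rwa [← mul_assoc])
  obtain ⟨q, hq, hxq⟩ := exists_eq_Pop_mul cs (a * u)
  have hxa := (isMinInCoset_Pop cs (a * u)).bruhatChain
    (mul_mem hq (inv_mem (ha.mem_parabolic_D hu hy)))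
  rw [← mul_assoc, ← hxq, mul_inv_cancel_right] at hxa
  exact hxa.trans hay

end CoxPop
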